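/- For every complex s with Re(s) > 0: ∫_0^∞ x^{s-1} (e^x + 1)^{-1} log x dx = Γ'(s)·η(s) + Γ(s)·η'(s), where Γ' and η' denote the derivatives of the Gamma function and of the Dirichlet eta function. -/

import Mathlib

open Filter Topology Finset MeasureTheory

/-- The Dirichlet eta function: `η(s) = (1 - 2^{1-s}) ζ(s)` for `s ≠ 1` and `η(1) = log 2`
(this is the entire function extending the alternating zeta series). -/
noncomputable def dirichletEta (s : ℂ) : ℂ :=
  if s = 1 then (Real.log 2 : ℂ) else (1 - 2 ^ (1 - s)) * riemannZeta s

/-- The alternating zeta series sums to `dirichletEta s` for `1 < re s`. -/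
theorem hasSum_dirichletEta {s : ℂ} (hs : 1 < s.re) :
    HasSum (fun n : ℕ ↦ (-1) ^ n / ((n : ℂ) + 1) ^ s) (dirichletEta s) := by
  have hs1 : s ≠ 1 := by rintro rfl; simp at hs
  have hsum : Summable fun n : ℕ ↦ 1 / ((n : ℂ) + 1) ^ s := by
    have := (summable_nat_add_iff 1).mpr (Complex.summable_one_div_nat_cpow.mpr hs)
    simpa using this
  have hzeta : HasSum (fun n : ℕ ↦ 1 / ((n : ℂ) + 1) ^ s) (riemannZeta s) := by
    rw [zeta_eq_tsum_one_div_nat_add_one_cpow hs]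
    exact hsum.hasSum
  have hodd : HasSum (fun k : ℕ ↦ 1 / (((2 * k + 1 : ℕ) : ℂ) + 1) ^ s)
      (2 ^ (-s) * riemannZeta s) := by
    refine (hzeta.mul_left (2 ^ (-s))).congr_fun ?_
    intro k
    have h : (((2 * k + 1 : ℕ) : ℂ) + 1) = ((2 : ℝ) : ℂ) * ((k + 1 : ℝ) : ℂ) := by
      push_cast; ring
    rw [h, Complex.mul_cpow_ofReal_nonneg (by norm_num) (by positivity), Complex.cpow_neg]
    push_cast
    field_simp
  obtain ⟨e, heven⟩ : Summable fun k : ℕ ↦ 1 / (((2 * k : ℕ) : ℂ) + 1) ^ s :=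
    hsum.comp_injective (mul_right_injective₀ (two_ne_zero' ℕ))
  have he : e + 2 ^ (-s) * riemannZeta s = riemannZeta s :=
    (HasSum.even_add_odd (f := fun n : ℕ ↦ 1 / ((n : ℂ) + 1) ^ s) heven hodd).unique hzeta
  have hval : dirichletEta s = e + -(2 ^ (-s) * riemannZeta s) := by
    rw [dirichletEta, if_neg hs1, eq_sub_of_add_eq he, sub_eq_add_neg 1 s,
      Complex.cpow_add _ _ two_ne_zero, Complex.cpow_one]
    ring
  rw [hval]
  refine HasSum.even_add_odd (f := fun n : ℕ ↦ (-1) ^ n / ((n : ℂ) + 1) ^ s) ?_ ?_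
  · simpa [pow_mul] using heven
  · simpa [pow_succ, pow_mul, neg_div] using hodd.neg

theorem tendsto_dirichletEta_one :
    Tendsto dirichletEta (𝓝[≠] 1) (𝓝 (Real.log 2 : ℂ)) := by
  have hd : HasDerivAt (fun s : ℂ ↦ 1 - (2 : ℂ) ^ (1 - s)) (Real.log 2 : ℂ) 1 := by
    have h := (((hasDerivAt_id (1 : ℂ)).const_sub 1).const_cpow (c := 2)
      (Or.inl two_ne_zero)).const_sub 1
    refine h.congr_deriv ?_
    simp
  have h := hd.tendsto_slope.mul riemannZeta_residue_one
  rw [mul_one] at h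
  refine h.congr' ?_
  filter_upwards [self_mem_nhdsWithin] with z hz
  have hz' : z - 1 ≠ 0 := sub_ne_zero.mpr hz
  rw [dirichletEta, if_neg (show z ≠ 1 from hz), slope_def_field]
  field_simp
  simp

theorem differentiable_dirichletEta : Differentiable ℂ dirichletEta := by
  rw [← differentiableOn_univ, ← Complex.differentiableOn_compl_singleton_and_continuousAt_iff
    (univ_mem : _ ∈ 𝓝 (1 : ℂ)), continuousAt_iff_punctured_nhds, ← Set.compl_eq_univ_sdiff]
  constructor
  · refine DifferentiableOn.congr (f := fun s ↦ (1 - (2 : ℂ) ^ (1 - s)) * riemannZeta s) ?_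
      fun z hz ↦ by rw [dirichletEta, if_neg (show z ≠ 1 from hz)]
    refine DifferentiableOn.fun_mul (Differentiable.differentiableOn ?_)
      differentiableOn_riemannZeta
    exact ((differentiable_id.const_sub 1).const_cpow (Or.inl two_ne_zero)).const_sub 1
  · simpa [dirichletEta] using tendsto_dirichletEta_one

theorem differentiableAt_Gamma_of_re_pos {s : ℂ} (hs : 0 < s.re) :
    DifferentiableAt ℂ Complex.Gamma s := by
  refine Complex.differentiableAt_Gamma s fun m h ↦ ?_
  rw [h, Complex.neg_re, Complex.natCast_re] at hs
  linarith [m.cast_nonneg (α := ℝ)]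

theorem hasSum_exp_neg_alternating {t : ℝ} (ht : 0 < t) :
    HasSum (fun n : ℕ ↦ (-1 : ℂ) ^ n * ((Real.exp (-((n : ℝ) + 1) * t) : ℝ) : ℂ))
      (Complex.exp t + 1)⁻¹ := by
  have hnorm : ‖-(Real.exp (-t) : ℂ)‖ < 1 := by
    rw [norm_neg, Complex.norm_real, Real.norm_eq_abs, Real.abs_exp, Real.exp_lt_one_iff]
    linarith
  have hval : (Complex.exp t + 1)⁻¹ = (Real.exp (-t) : ℂ) * (1 - -(Real.exp (-t) : ℂ))⁻¹ := by
    have h : (Real.exp t + 1)⁻¹ = Real.exp (-t) * (1 - -Real.exp (-t))⁻¹ := by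
      have := Real.exp_pos t
      have : Real.exp t + 1 ≠ 0 := by positivity
      rw [Real.exp_neg, sub_neg_eq_add]
      field_simp
    exact_mod_cast congrArg Complex.ofReal h
  rw [hval]
  refine ((hasSum_geometric_of_norm_lt_one hnorm).mul_left (Real.exp (-t) : ℂ)).congr_fun
    fun n ↦ ?_
  rw [show -((n : ℝ) + 1) * t = n * (-t) + (-t) by ring, Real.exp_add, Real.exp_nat_mul,
    neg_pow (Real.exp (-t) : ℂ)]
  push_cast
  ring

theorem mellin_inv_exp_add_one_of_one_lt_re {s : ℂ} (hs : 1 < s.re) :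
    mellin (fun t : ℝ ↦ (Complex.exp t + 1)⁻¹) s = Complex.Gamma s * dirichletEta s := by
  have h := hasSum_mellin (a := fun n : ℕ ↦ (-1 : ℂ) ^ n) (p := fun n : ℕ ↦ (n : ℝ) + 1)
    (F := fun t : ℝ ↦ (Complex.exp t + 1)⁻¹) (s := s) (fun n ↦ Or.inr (by positivity))
    (by linarith) (fun t ht ↦ hasSum_exp_neg_alternating ht) ?_
  · refine h.unique ?_
    refine ((hasSum_dirichletEta hs).mul_left (Complex.Gamma s)).congr_fun fun n ↦ ?_
    push_cast
    ring
  · have := (summable_nat_add_iff 1).mpr (Real.summable_one_div_nat_rpow.mpr hs)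
    simpa using this

theorem norm_inv_exp_add_one (t : ℝ) :
    ‖(Complex.exp t + 1)⁻¹‖ = (Real.exp t + 1)⁻¹ := by
  have h : (Complex.exp t + 1)⁻¹ = (((Real.exp t + 1)⁻¹ : ℝ) : ℂ) := by push_cast; rfl
  rw [h, Complex.norm_real, Real.norm_of_nonneg (by positivity)]

theorem hasDerivAt_mellin_inv_exp_add_one {s : ℂ} (hs : 0 < s.re) :
    HasDerivAt (mellin fun t : ℝ ↦ (Complex.exp t + 1)⁻¹)
      (mellin (fun t : ℝ ↦ Real.log t • (Complex.exp t + 1)⁻¹) s) s := by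
  refine (mellin_hasDerivAt_of_isBigO_rpow (a := s.re + 1) (b := 0) ?_ ?_ (lt_add_one _) ?_ hs).2
  · refine (Continuous.locallyIntegrable ?_).locallyIntegrableOn _
    refine Continuous.inv₀ (by fun_prop) fun t h ↦ ?_
    have := norm_inv_exp_add_one t
    rw [h, inv_zero, norm_zero] at this
    have : 0 < (Real.exp t + 1)⁻¹ := by positivity
    linarith
  · refine Asymptotics.IsBigO.trans ?_ (isLittleO_exp_neg_mul_rpow_atTop one_pos _).isBigO
    refine Asymptotics.IsBigO.of_bound' (Eventually.of_forall fun t ↦ ?_)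
    rw [norm_inv_exp_add_one, Real.norm_eq_abs, Real.abs_exp, neg_one_mul, Real.exp_neg]
    gcongr
    linarith
  · refine Asymptotics.IsBigO.of_bound' (Eventually.of_forall fun t ↦ ?_)
    rw [norm_inv_exp_add_one, neg_zero, Real.rpow_zero, norm_one]
    exact inv_le_one_of_one_le₀ (by linarith [Real.exp_pos t])

theorem eqOn_mellin_inv_exp_add_one :
    Set.EqOn (mellin fun t : ℝ ↦ (Complex.exp t + 1)⁻¹)
      (fun s ↦ Complex.Gamma s * dirichletEta s) {s | 0 < s.re} := by
  have hopen : IsOpen {s : ℂ | 0 < s.re} := isOpen_lt continuous_const Complex.continuous_re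
  refine AnalyticOnNhd.eqOn_of_preconnected_of_eventuallyEq (z₀ := 2)
    (DifferentiableOn.analyticOnNhd ?_ hopen) (DifferentiableOn.analyticOnNhd ?_ hopen)
    (convex_halfSpace_re_gt 0).isPreconnected (by simp) ?_
  · exact fun s hs ↦
      (hasDerivAt_mellin_inv_exp_add_one hs).differentiableAt.differentiableWithinAt
  · exact fun s hs ↦ ((differentiableAt_Gamma_of_re_pos hs).fun_mul
      (differentiable_dirichletEta s)).differentiableWithinAt
  · filter_upwards [(isOpen_lt continuous_const Complex.continuous_re).mem_nhds
      (show (1 : ℝ) < (2 : ℂ).re by norm_num)] with s hs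
    exact mellin_inv_exp_add_one_of_one_lt_re hs

/-- For `Re s > 0`: `∫_0^∞ x^{s-1} (e^x + 1)^{-1} log x dx = Γ'(s) η(s) + Γ(s) η'(s)`. -/
theorem integral_log_over_exp_add_one (s : ℂ) (hs : 0 < s.re) :
    ∫ x : ℝ in Set.Ioi 0, (x : ℂ) ^ (s - 1) * (Complex.exp (x : ℂ) + 1)⁻¹ * (Real.log x : ℂ) =
      deriv Complex.Gamma s * dirichletEta s + Complex.Gamma s * deriv dirichletEta s := by
  have hopen : IsOpen {s : ℂ | 0 < s.re} := isOpen_lt continuous_const Complex.continuous_re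
  have hGamma : DifferentiableAt ℂ Complex.Gamma s := differentiableAt_Gamma_of_re_pos hs
  have hprod := hGamma.hasDerivAt.fun_mul (differentiable_dirichletEta s).hasDerivAt
  have hmellin := hprod.congr_of_eventuallyEq
    (eqOn_mellin_inv_exp_add_one.eventuallyEq_of_mem (hopen.mem_nhds hs))
  rw [← (hasDerivAt_mellin_inv_exp_add_one hs).unique hmellin, mellin]
  refine integral_congr_ae (Eventually.of_forall fun x ↦ ?_)
  simp only [smul_eq_mul, Complex.real_smul]
  ring
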